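/- arXiv:1505.06978 — 2 statements merged into one kernel-verified Lean document; each statement's English description precedes it below -/
import Mathlib

section
/- Let n ≥ 2 be an integer, let Ω ⊆ ℝⁿ be open, let p, q > 0 be real numbers, and let u, v : Ω → ℝ be twice continuously differentiable functions with u > 0 and v > 0 on Ω satisfying −Δu = v^p and −Δv = u^q on Ω. Then for every closed ball B̄(x₀,r) ⊆ Ω and every index j ∈ {1,…,n}: −∫_{∂B(x₀,r)} (∂u/∂ν · ∂v/∂x_j + ∂v/∂ν · ∂u/∂x_j) dS + ∫_{∂B(x₀,r)} (∇u·∇v) ν_j dS = (1/(p+1)) ∫_{∂B(x₀,r)} v^{p+1} ν_j dS + (1/(q+1)) ∫_{∂B(x₀,r)} u^{q+1} ν_j dS. -/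
open MeasureTheory Metric Filter Topology RealInnerProductSpace

noncomputable section

abbrev Euc (n : ℕ) := EuclideanSpace ℝ (Fin n)

/-- `(n-1)`-dimensional Hausdorff measure, used as the surface measure `dS` on spheres. -/
noncomputable def surf (n : ℕ) : Measure (Euc n) := μH[(n : ℝ) - 1]

/-- Laplacian on `ℝⁿ`. -/
noncomputable def lap (n : ℕ) (u : Euc n → ℝ) (x : Euc n) : ℝ :=
  ∑ i : Fin n, fderiv ℝ (fun y => fderiv ℝ u y (EuclideanSpace.single i 1)) x
    (EuclideanSpace.single i 1)

theorem exists_integral_eq_const_mul_of_measure_ball_eq {X : Type*} [MetricSpace X]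
    [CompactSpace X] [Nonempty X] [MeasurableSpace X] [BorelSpace X] (τ σ : Measure X)
    [IsFiniteMeasure σ] [σ.IsOpenPosMeasure]
    (hτ : ∀ x y ε, τ (ball x ε) = τ (ball y ε)) (hσ : ∀ x y ε, σ (ball x ε) = σ (ball y ε)) :
    ∃ c : ℝ, ∀ f : X → ℝ, Continuous f → ∫ x, f x ∂τ = c * ∫ x, f x ∂σ := by
  by_cases hfin : τ Set.univ = ⊤
  · have hball : ∀ x : X, ∀ ε > 0, τ (ball x ε) = ⊤ := by
      intro x ε hε
      by_contra hne
      obtain ⟨t, -, ht, hcov⟩ := finite_cover_balls_of_compact (isCompact_univ (X := X)) hε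
      have h1 : τ (⋃ y ∈ t, ball y ε) < ⊤ :=
        measure_biUnion_lt_top ht fun y _ => by
          rw [hτ y x]; exact lt_top_iff_ne_top.2 hne
      exact (measure_mono hcov).not_gt (by rw [hfin]; exact h1)
    refine ⟨0, fun f hf => ?_⟩
    rw [zero_mul]
    by_cases hint : Integrable f τ
    · have : f = 0 := by
        by_contra hne
        obtain ⟨x, hx⟩ := Function.ne_iff.1 hne
        have hpos : 0 < ‖f x‖ := norm_pos_iff.2 hx
        have h1 := hint.measure_norm_ge_lt_top (half_pos hpos)
        obtain ⟨ε, hε, hsub⟩ := Metric.mem_nhds_iff.1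
          ((isOpen_lt continuous_const hf.norm).mem_nhds (half_lt_self hpos))
        have h2 : τ (ball x ε) < ⊤ :=
          (measure_mono fun y hy => (show ‖f x‖ / 2 < ‖f y‖ from hsub hy).le).trans_lt h1
        exact h2.ne (hball x ε hε)
      simp [this]
    · exact integral_undef hint
  · have : IsFiniteMeasure τ := ⟨lt_top_iff_ne_top.2 hfin⟩
    obtain ⟨x₀⟩ := ‹Nonempty X›
    have hS : 0 < σ.real Set.univ := ENNReal.toReal_pos
      (isOpen_univ.measure_ne_zero _ ⟨x₀, trivial⟩) (measure_ne_top _ _)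
    refine ⟨τ.real Set.univ / σ.real Set.univ, fun f hf => ?_⟩
    have hfτ : ∀ (μ : Measure X) [IsFiniteMeasure μ], Integrable f μ := fun μ _ =>
      hf.integrable_of_hasCompactSupport (HasCompactSupport.of_compactSpace f)
    refine eq_of_forall_dist_le fun η hη => ?_
    set T := τ.real Set.univ with hT
    set S := σ.real Set.univ with hSdef
    have hT0 : 0 ≤ T := measureReal_nonneg
    obtain ⟨ω, hω, hωη⟩ : ∃ ω > 0, ω * T ≤ η :=
      ⟨η / (T + 1), by positivity, by
        rw [div_mul_eq_mul_div, div_le_iff₀ (by positivity)]; nlinarith⟩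
    obtain ⟨ε, hε, hunif⟩ :=
      Metric.uniformContinuous_iff.1 (CompactSpace.uniformContinuous_of_continuous hf) ω hω
    set A := τ.real (ball x₀ ε)
    set B := σ.real (ball x₀ ε)
    have hB : 0 < B := ENNReal.toReal_pos
      (isOpen_ball.measure_ne_zero _ ⟨x₀, mem_ball_self hε⟩) (measure_ne_top _ _)
    let K : X × X → ℝ := Set.indicator {z | dist z.1 z.2 < ε} 1
    have hKm : MeasurableSet {z : X × X | dist z.1 z.2 < ε} :=
      (isOpen_lt continuous_dist continuous_const).measurableSet
    have hKint : ∀ g : X × X → ℝ, Integrable g (τ.prod σ) →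
        Integrable (fun z => K z * g z) (τ.prod σ) := by
      intro g hg
      refine (hg.indicator hKm).congr (ae_of_all _ fun z => ?_)
      by_cases hz : dist z.1 z.2 < ε <;> simp [K, Set.indicator, hz]
    have hKσ : ∀ x, ∫ y, K (x, y) ∂σ = B := by
      intro x
      have : (fun y => K (x, y)) = Set.indicator (ball x ε) 1 := by
        ext y; simp [K, Set.indicator, dist_comm]
      rw [this, integral_indicator_one measurableSet_ball, measureReal_def, hσ x x₀]
      rfl
    have hKτ : ∀ y, ∫ x, K (x, y) ∂τ = A := by
      intro y
      have : (fun x => K (x, y)) = Set.indicator (ball y ε) 1 := by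
        ext x; simp [K, Set.indicator]
      rw [this, integral_indicator_one measurableSet_ball, measureReal_def, hτ y x₀]
      rfl
    have i1 : Integrable (fun z : X × X => f z.1) (τ.prod σ) := (hfτ τ).comp_fst σ
    have i2 : Integrable (fun z : X × X => f z.2) (τ.prod σ) := (hfτ σ).comp_snd τ
    have e1 : ∫ z, K z * f z.1 ∂(τ.prod σ) = B * ∫ x, f x ∂τ := by
      rw [integral_prod _ (hKint _ i1)]
      simp only [integral_mul_const, hKσ, integral_const_mul]
    have e2 : ∫ z, K z * f z.2 ∂(τ.prod σ) = A * ∫ x, f x ∂σ := by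
      rw [integral_prod_symm _ (hKint _ i2)]
      simp only [integral_mul_const, hKτ, integral_const_mul]
    have iK : Integrable K (τ.prod σ) := by
      simpa using hKint (fun _ => 1) (integrable_const _)
    have e3 : ∫ z, K z ∂(τ.prod σ) = B * T := by
      rw [integral_prod _ iK]
      simp [hKσ, hT, mul_comm]
    have e4 : ∫ z, K z ∂(τ.prod σ) = A * S := by
      rw [integral_prod_symm _ iK]
      simp [hKτ, hSdef, mul_comm]
    have key : |B * ∫ x, f x ∂τ - A * ∫ x, f x ∂σ| ≤ ω * (B * T) := by
      rw [← e1, ← e2, ← integral_sub (hKint _ i1) (hKint _ i2), ← e3, ← integral_const_mul,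
        ← Real.norm_eq_abs]
      refine norm_integral_le_of_norm_le (iK.const_mul ω) (ae_of_all _ fun z => ?_)
      by_cases hz : dist z.1 z.2 < ε
      · have h1 : K z = 1 := by simp [K, hz]
        have := hunif hz
        rw [Real.dist_eq] at this
        simpa [h1] using this.le
      · have h1 : K z = 0 := by simp [K, hz]
        simp [h1]
    have hA : A = B * T / S := by
      rw [eq_div_iff hS.ne', ← e4, e3]
    rw [hA] at key
    have h5 : B * ∫ x, f x ∂τ - B * T / S * ∫ x, f x ∂σ
        = B * (∫ x, f x ∂τ - T / S * ∫ x, f x ∂σ) := by ring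
    rw [h5, abs_mul, abs_of_pos hB] at key
    rw [Real.dist_eq]
    refine le_trans (le_of_mul_le_mul_left ?_ hB) hωη
    linarith

section
variable {E : Type*} [NormedAddCommGroup E] [InnerProductSpace ℝ E] 

theorem exists_linearIsometryEquiv_preimage_coe_ball (x y : sphere (0 : E) 1) :
    ∃ T : E ≃ₗᵢ[ℝ] E, ∀ ε, T ⁻¹' ((↑) '' ball y ε) = ((↑) '' ball x ε : Set E) := by
  have hxy : ‖(x : E)‖ = ‖(y : E)‖ := by simp
  refine ⟨(ℝ ∙ ((x : E) - y))ᗮ.reflection, fun ε => ?_⟩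
  have hT := Submodule.reflection_sub hxy
  set T := (ℝ ∙ ((x : E) - y))ᗮ.reflection
  ext z
  have h : dist z (T.symm y) = dist (T z) y := by rw [← T.dist_map, T.apply_symm_apply]
  have hx : (x : E) = T.symm y := by rw [← hT, T.symm_apply_apply]
  simp [hx, h]

open Pointwise in
theorem toSphere_ball_eq [FiniteDimensional ℝ E] [MeasurableSpace E] [BorelSpace E]
    (x y : sphere (0 : E) 1) (ε : ℝ) :
    (volume : Measure E).toSphere (ball x ε) = (volume : Measure E).toSphere (ball y ε) := by
  obtain ⟨T, hT⟩ := exists_linearIsometryEquiv_preimage_coe_ball x y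
  rw [Measure.toSphere_apply' _ measurableSet_ball, Measure.toSphere_apply' _ measurableSet_ball,
    ← hT, ← T.measurePreserving.measure_preimage_emb T.toHomeomorph.measurableEmbedding
      (Set.Ioo (0 : ℝ) 1 • ((↑) '' ball y ε : Set E))]
  congr 2
  ext z
  simp only [Set.mem_smul, Set.mem_preimage]
  constructor
  · rintro ⟨a, ha, b, hb, rfl⟩
    exact ⟨a, ha, T b, hb, (map_smul T a b).symm⟩
  · rintro ⟨a, ha, b, hb, h⟩
    exact ⟨a, ha, T.symm b, by simpa using hb, T.injective (by simp [h])⟩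

theorem measurableEmbedding_add_smul_sphere [MeasurableSpace E] [BorelSpace E]
    (x₀ : E) {r : ℝ} (hr : r ≠ 0) :
    MeasurableEmbedding fun θ : sphere (0 : E) 1 => x₀ + r • (θ : E) :=
  (((Homeomorph.smulOfNeZero r hr).trans (Homeomorph.addLeft x₀)).measurableEmbedding).comp
    (MeasurableEmbedding.subtype_coe isClosed_sphere.measurableSet)

theorem range_add_smul_sphere (x₀ : E) {r : ℝ} (hr : 0 < r) :
    Set.range (fun θ : sphere (0 : E) 1 => x₀ + r • (θ : E)) = sphere x₀ r := by
  ext z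
  simp only [Set.mem_range, Subtype.exists, mem_sphere_iff_norm, sub_zero]
  constructor
  · rintro ⟨a, ha, rfl⟩
    simp [norm_smul, ha, abs_of_pos hr]
  · intro h
    exact ⟨r⁻¹ • (z - x₀), by simp [norm_smul, h, abs_of_pos hr, hr.ne'], by simp [hr.ne']⟩

theorem comap_hausdorffMeasure_ball_eq [MeasurableSpace E] [BorelSpace E] (d : ℝ)
    (x₀ : E) {r : ℝ} (hr : r ≠ 0) (x y : sphere (0 : E) 1) (ε : ℝ) :
    (μH[d] : Measure E).comap (fun θ : sphere (0 : E) 1 => x₀ + r • (θ : E)) (ball x ε) =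
      (μH[d] : Measure E).comap (fun θ : sphere (0 : E) 1 => x₀ + r • (θ : E)) (ball y ε) := by
  have hemb := measurableEmbedding_add_smul_sphere x₀ hr
  obtain ⟨T, hT⟩ := exists_linearIsometryEquiv_preimage_coe_ball x y
  let e : E ≃ᵢ E := ((IsometryEquiv.addLeft x₀).symm.trans T.toIsometryEquiv).trans
    (IsometryEquiv.addLeft x₀)
  have he : ∀ z, e (x₀ + r • z) = x₀ + r • T z := fun z => by simp [e]
  have himg : ∀ s : Set (sphere (0 : E) 1),
      (fun θ : sphere (0 : E) 1 => x₀ + r • (θ : E)) '' s = (fun z => x₀ + r • z) '' ((↑) '' s) :=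
    fun s => by rw [Set.image_image]
  rw [hemb.comap_apply, hemb.comap_apply, himg, himg, ← e.hausdorffMeasure_image, ← hT]
  congr 1
  rw [Set.image_image]
  simp only [he]
  rw [← Set.image_image (fun z => x₀ + r • z) T, Set.image_preimage_eq _ T.surjective]

theorem exists_setIntegral_sphere_hausdorffMeasure_eq [FiniteDimensional ℝ E] [Nontrivial E]
    [MeasurableSpace E] [BorelSpace E] (d : ℝ) (x₀ : E) {r : ℝ} (hr : 0 < r) :
    ∃ c : ℝ, ∀ f : E → ℝ, ContinuousOn f (sphere x₀ r) →
      ∫ x in sphere x₀ r, f x ∂μH[d] =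
        c * ∫ θ : sphere (0 : E) 1, f (x₀ + r • (θ : E)) ∂(volume : Measure E).toSphere := by
  have hemb := measurableEmbedding_add_smul_sphere x₀ hr.ne'
  have : Nonempty (sphere (0 : E) 1) := (NormedSpace.sphere_nonempty.2 zero_le_one).to_subtype
  have : CompactSpace (sphere (0 : E) 1) := isCompact_iff_compactSpace.1 (isCompact_sphere 0 1)
  obtain ⟨c, hc⟩ := exists_integral_eq_const_mul_of_measure_ball_eq
    ((μH[d] : Measure E).comap (fun θ : sphere (0 : E) 1 => x₀ + r • (θ : E)))
    (volume : Measure E).toSphere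
    (comap_hausdorffMeasure_ball_eq d x₀ hr.ne') toSphere_ball_eq
  refine ⟨c, fun f hf => ?_⟩
  rw [← hc (fun θ => f (x₀ + r • (θ : E))), ← range_add_smul_sphere x₀ hr, ← hemb.map_comap,
    hemb.integral_map]
  refine hf.comp_continuous (by fun_prop) fun θ => ?_
  rw [← range_add_smul_sphere x₀ hr]
  exact ⟨θ, rfl⟩
end

theorem integral_fderiv_apply_eq_zero {E : Type*} [NormedAddCommGroup E] [NormedSpace ℝ E]
    [FiniteDimensional ℝ E] [MeasurableSpace E] [BorelSpace E] (μ : Measure E)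
    [μ.IsAddHaarMeasure] {f : E → ℝ} (hf : ContDiff ℝ 1 f) (hc : HasCompactSupport f) (w : E) :
    Integrable (fun x => fderiv ℝ f x w) μ ∧ ∫ x, fderiv ℝ f x w ∂μ = 0 := by
  have hint : Integrable (fun x => fderiv ℝ f x w) μ :=
    ((hf.continuous_fderiv one_ne_zero).clm_apply continuous_const).integrable_of_hasCompactSupport
      (hc.fderiv_apply ℝ w)
  refine ⟨hint, ?_⟩
  have := integral_mul_fderiv_eq_neg_fderiv_mul_of_integrable (μ := μ) (f := fun _ : E => (1 : ℝ))
    (g := f) (v := w) (by simp) (by simpa using hint)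
    (by simpa using hf.continuous.integrable_of_hasCompactSupport hc)
    (fun x _ => differentiableAt_const _) (fun x _ => hf.differentiable one_ne_zero x)
  simpa using this

theorem integral_radial_mul_eq_zero_of_divergence_eq_zero {n : ℕ} {U : Set (Euc n)}
    (hU : IsOpen U) {G : Fin n → Euc n → ℝ} (hG : ∀ i, ContDiffOn ℝ 1 (G i) U)
    (hdiv : ∀ x ∈ U, ∑ i, fderiv ℝ (G i) x (EuclideanSpace.single i 1) = 0)
    {x₀ : Euc n} {R : ℝ} (hR : 0 ≤ R) (hball : closedBall x₀ R ⊆ U) {k : ℝ → ℝ}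
    (hk : Continuous k) (hk0 : ∀ t, R ^ 2 ≤ t → k t = 0) :
    ∫ x, k (‖x - x₀‖ ^ 2) * ∑ i, G i x * (x - x₀) i = 0 := by
  let H : ℝ → ℝ := fun t => ∫ s in (R ^ 2)..t, k s
  have hH : ∀ t, HasDerivAt H (k t) t := fun t => hk.integral_hasStrictDerivAt _ t |>.hasDerivAt
  have hHd : ContDiff ℝ 1 H := by
    rw [contDiff_one_iff_deriv]
    refine ⟨fun t => (hH t).differentiableAt, ?_⟩
    rwa [funext fun t => (hH t).deriv]
  have hH0 : ∀ t, R ^ 2 ≤ t → H t = 0 := by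
    intro t ht
    refine intervalIntegral.integral_zero_ae (ae_of_all _ fun s hs => hk0 s ?_)
    rw [Set.uIoc_of_le ht] at hs
    exact hs.1.le
  let φ : Euc n → ℝ := fun x => H (‖x - x₀‖ ^ 2)
  have hφ : ContDiff ℝ 1 φ := hHd.comp ((contDiff_id.sub contDiff_const).norm_sq ℝ)
  have hφ' : ∀ x w, fderiv ℝ φ x w = 2 * (k (‖x - x₀‖ ^ 2) * ⟪x - x₀, w⟫) := by
    intro x w
    have h1 : HasFDerivAt (fun y : Euc n => ‖y - x₀‖ ^ 2) _ x :=
      ((hasFDerivAt_id x).sub_const x₀).norm_sq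
    have h2 := (hH (‖x - x₀‖ ^ 2)).comp_hasFDerivAt x h1
    rw [show φ = H ∘ fun y => ‖y - x₀‖ ^ 2 from rfl, h2.fderiv]
    simp [inner_sub_left]
    ring
  have hout : ∀ x ∉ closedBall x₀ R, R ^ 2 ≤ ‖x - x₀‖ ^ 2 := by
    intro x hx
    rw [mem_closedBall_iff_norm, not_le] at hx
    exact pow_le_pow_left₀ hR hx.le 2
  have hφ0 : ∀ x ∉ closedBall x₀ R, φ x = 0 := fun x hx => hH0 _ (hout x hx)
  have hzero : ∀ i, ∀ x ∉ closedBall x₀ R, (fun y => φ y * G i y) =ᶠ[𝓝 x] fun _ => 0 := by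
    intro i x hx
    filter_upwards [isClosed_closedBall.isOpen_compl.mem_nhds hx] with y hy
    rw [hφ0 y hy, zero_mul]
  have hf : ∀ i, ContDiff ℝ 1 fun y => φ y * G i y := by
    intro i
    rw [contDiff_iff_contDiffAt]
    intro x
    by_cases hx : x ∈ closedBall x₀ R
    · exact hφ.contDiffAt.mul ((hG i).contDiffAt (hU.mem_nhds (hball hx)))
    · exact contDiffAt_const.congr_of_eventuallyEq (hzero i x hx)
  have hfc : ∀ i, HasCompactSupport fun y => φ y * G i y := fun i =>
    HasCompactSupport.intro (isCompact_closedBall x₀ R) fun x hx => by rw [hφ0 x hx, zero_mul]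
  have hint := fun i => integral_fderiv_apply_eq_zero volume (hf i) (hfc i)
    (EuclideanSpace.single i 1)
  have hsum : ∫ x, ∑ i, fderiv ℝ (fun y => φ y * G i y) x (EuclideanSpace.single i 1) = 0 := by
    rw [integral_finsetSum _ fun i _ => (hint i).1]
    exact Finset.sum_eq_zero fun i _ => (hint i).2
  have hpt : ∀ x, ∑ i, fderiv ℝ (fun y => φ y * G i y) x (EuclideanSpace.single i 1) =
      2 * (k (‖x - x₀‖ ^ 2) * ∑ i, G i x * (x - x₀) i) := by
    intro x
    by_cases hx : x ∈ closedBall x₀ R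
    · have h1 : ∀ i, fderiv ℝ (fun y => φ y * G i y) x (EuclideanSpace.single i 1) =
          φ x * fderiv ℝ (G i) x (EuclideanSpace.single i 1) +
            2 * (k (‖x - x₀‖ ^ 2) * (G i x * (x - x₀) i)) := by
        intro i
        rw [fderiv_fun_mul (hφ.differentiable one_ne_zero x)
          (((hG i).contDiffAt (hU.mem_nhds (hball hx))).differentiableAt one_ne_zero)]
        simp [hφ', EuclideanSpace.inner_single_right]
        ring
      rw [Finset.sum_congr rfl fun i _ => h1 i, Finset.sum_add_distrib, ← Finset.mul_sum,
        hdiv x (hball hx), mul_zero, zero_add, Finset.mul_sum, Finset.mul_sum]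
    · rw [hk0 _ (hout x hx), zero_mul, mul_zero]
      refine Finset.sum_eq_zero fun i _ => ?_
      rw [(hzero i x hx).fderiv_eq]
      simp
  simp only [hpt, integral_const_mul] at hsum
  simpa using hsum

theorem integral_eq_integral_Ioi_integral_sphere {E : Type*} [NormedAddCommGroup E]
    [NormedSpace ℝ E] [FiniteDimensional ℝ E] [Nontrivial E] [MeasurableSpace E] [BorelSpace E]
    (μ : Measure E) [μ.IsAddHaarMeasure] {f : E → ℝ} (hf : Integrable f μ) :
    ∫ x, f x ∂μ = ∫ s in Set.Ioi (0 : ℝ),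
      s ^ (Module.finrank ℝ E - 1) * ∫ θ : sphere (0 : E) 1, f (s • (θ : E)) ∂μ.toSphere := by
  have hmp := μ.measurePreserving_homeomorphUnitSphereProd.symm
    (homeomorphUnitSphereProd E).toMeasurableEquiv
  have hemb := (homeomorphUnitSphereProd E).symm.measurableEmbedding
  have hms : MeasurableSet ({(0 : E)}ᶜ) := (measurableSet_singleton _).compl
  have hf' : Integrable (fun x : ({(0 : E)}ᶜ : Set E) => f x) (μ.comap (↑)) :=
    ((MeasurableEmbedding.subtype_coe hms).integrable_map_iff).1 (by
      rw [map_comap_subtype_coe hms]; exact hf.integrableOn)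
  have h1 : ∫ x, f x ∂μ = ∫ z, f (z.2.1 • (z.1 : E))
      ∂(μ.toSphere.prod (.volumeIoiPow (Module.finrank ℝ E - 1))) := by
    rw [← restrict_compl_singleton (μ := μ) 0, ← integral_subtype_comap hms f]
    rw [← hmp.integral_comp hemb]
    simp
  rw [h1, integral_prod_symm]
  · simp only [Measure.volumeIoiPow]
    rw [integral_withDensity_eq_integral_toReal_smul₀]
    · rw [← integral_subtype_comap measurableSet_Ioi]
      refine integral_congr_ae (ae_of_all _ fun s => ?_)
      simp [ENNReal.toReal_ofReal (pow_nonneg (le_of_lt s.2) _)]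
    · fun_prop
    · exact ae_of_all _ fun s => ENNReal.ofReal_lt_top
  · rw [← hmp.integrable_comp_emb hemb] at hf'
    simpa [Function.comp_def] using hf'

theorem integral_sphere_inner_normal_eq_zero {n : ℕ} [NeZero n] {U : Set (Euc n)}
    (hU : IsOpen U) {G : Fin n → Euc n → ℝ} (hG : ∀ i, ContDiffOn ℝ 1 (G i) U)
    (hdiv : ∀ x ∈ U, ∑ i, fderiv ℝ (G i) x (EuclideanSpace.single i 1) = 0)
    {x₀ : Euc n} {r : ℝ} (hr : 0 < r) (hball : closedBall x₀ r ⊆ U) :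
    ∫ θ : sphere (0 : Euc n) 1, ∑ i, G i (x₀ + r • (θ : Euc n)) * (θ : Euc n) i
      ∂(volume : Measure (Euc n)).toSphere = 0 := by
  obtain ⟨R, hrR, hRU⟩ : ∃ R, r < R ∧ closedBall x₀ R ⊆ U := by
    obtain ⟨δ, hδ, h⟩ := (isCompact_closedBall x₀ r).exists_cthickening_subset_open hU hball
    refine ⟨r + δ, by linarith, ?_⟩
    rwa [cthickening_closedBall hδ.le hr.le, add_comm] at h
  have hR : 0 < R := hr.trans hrR
  have : CompactSpace (sphere (0 : Euc n) 1) := isCompact_iff_compactSpace.1 (isCompact_sphere 0 1)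
  set σ := (volume : Measure (Euc n)).toSphere with hσ
  let P : Euc n → ℝ := fun x => ∑ i, G i (x₀ + x) * x i
  have hmem : ∀ {x : Euc n}, ‖x‖ ≤ R → x₀ + x ∈ U := fun hx => hRU (by simpa using hx)
  have hP : ContinuousOn P (closedBall 0 R) := by
    refine continuousOn_finsetSum _ fun i _ => ContinuousOn.mul ?_ (by fun_prop)
    exact (hG i).continuousOn.comp (by fun_prop) fun x hx => hmem (by simpa using hx)
  let c : ℝ → ℝ := fun s => max 0 (min s R)
  have hc : ∀ s, 0 ≤ s → s ≤ R → c s = s := fun s h0 h1 => by simp [c, h0, h1]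
  let g : ℝ → ℝ := fun s => ∫ θ : sphere (0 : Euc n) 1, P (c s • (θ : Euc n)) ∂σ
  have hg : Continuous g := by
    have := continuous_parametric_integral_of_continuous (μ := σ)
      (f := fun s (θ : sphere (0 : Euc n) 1) => P (c s • (θ : Euc n))) ?_ isCompact_univ
    · simpa using this
    · refine hP.comp_continuous (by fun_prop) fun z => ?_
      have h0 : 0 ≤ c z.1 := le_max_left _ _
      have h1 : c z.1 ≤ R := max_le hR.le (min_le_right _ _)
      simpa [norm_smul, abs_of_nonneg h0] using h1
  let k : ℝ → ℝ := fun t => g (√t) * max 0 (R ^ 2 - t)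
  have hk : Continuous k := by fun_prop
  have hk0 : ∀ t, R ^ 2 ≤ t → k t = 0 := fun t ht => by simp [k, ht]
  have h1 := integral_radial_mul_eq_zero_of_divergence_eq_zero hU hG hdiv hR.le hRU hk hk0
  rw [← integral_add_left_eq_self _ x₀] at h1
  simp only [add_sub_cancel_left] at h1
  change ∫ x, k (‖x‖ ^ 2) * P x = 0 at h1
  have hint : Integrable fun x : Euc n => k (‖x‖ ^ 2) * P x := by
    rw [← integrableOn_iff_integrable_of_support_subset (s := closedBall 0 R)]
    · exact ContinuousOn.integrableOn_compact (isCompact_closedBall 0 R)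
        (ContinuousOn.mul (by fun_prop) hP)
    · intro x hx
      by_contra hn
      rw [mem_closedBall_zero_iff, not_le] at hn
      exact hx (by simp [hk0 _ (pow_le_pow_left₀ hR.le hn.le 2)])
  rw [integral_eq_integral_Ioi_integral_sphere volume hint, finrank_euclideanSpace_fin] at h1
  let h : ℝ → ℝ := fun s => s ^ (n - 1) * (max 0 (R ^ 2 - s ^ 2) * g s ^ 2)
  have hh : Continuous h := by fun_prop
  have h2 : ∫ s in Set.Ioi (0 : ℝ), h s = 0 := by
    refine Eq.trans ?_ h1
    apply setIntegral_congr_fun measurableSet_Ioi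
    intro s (hs : 0 < s)
    have hnorm : ∀ θ : sphere (0 : Euc n) 1, ‖s • (θ : Euc n)‖ ^ 2 = s ^ 2 := fun θ => by
      simp [norm_smul]
    simp only [hnorm, integral_const_mul, h, k, Real.sqrt_sq hs.le, ← hσ]
    rcases le_total s R with hsR | hsR
    · simp only [g, hc s hs.le hsR]
      ring
    · have : R ^ 2 - s ^ 2 ≤ 0 := sub_nonpos.2 (pow_le_pow_left₀ hR.le hsR 2)
      simp [max_eq_left this]
  have hnonneg : ∀ s ∈ Set.Ioi (0 : ℝ), 0 ≤ h s := fun s (hs : 0 < s) => by positivity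
  have hintOn : IntegrableOn h (Set.Ioi 0) := by
    have : IntegrableOn h (Set.Ioc 0 R) := (hh.integrableOn_Icc).mono_set Set.Ioc_subset_Icc_self
    refine this.of_forall_sdiff_eq_zero measurableSet_Ioi fun s hs => ?_
    have hsR : R ≤ s := by
      by_contra hn
      exact hs.2 ⟨hs.1, (not_le.1 hn).le⟩
    have : R ^ 2 - s ^ 2 ≤ 0 := sub_nonpos.2 (pow_le_pow_left₀ hR.le hsR 2)
    simp [h, max_eq_left this]
  rw [setIntegral_eq_zero_iff_of_nonneg_ae
    ((ae_restrict_iff' measurableSet_Ioi).2 (ae_of_all _ hnonneg)) hintOn] at h2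
  have h3 : h r = 0 := Measure.eqOn_open_of_ae_eq h2 isOpen_Ioi hh.continuousOn
    continuousOn_const hr
  have h4 : 0 < max 0 (R ^ 2 - r ^ 2) :=
    lt_max_of_lt_right (sub_pos.2 (pow_lt_pow_left₀ hrR hr.le two_ne_zero))
  have h5 : g r = 0 := by
    have := (mul_eq_zero.1 h3).resolve_left (pow_pos hr _).ne'
    exact pow_eq_zero_iff two_ne_zero |>.1 ((mul_eq_zero.1 this).resolve_left h4.ne')
  have h6 : g r = r * ∫ θ : sphere (0 : Euc n) 1,
      ∑ i, G i (x₀ + r • (θ : Euc n)) * (θ : Euc n) i ∂σ := by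
    rw [← integral_const_mul]
    simp only [g, hc r hr.le hrR.le, P, Finset.mul_sum]
    simp [mul_left_comm]
  exact (mul_eq_zero.1 (h6.symm.trans h5)).resolve_left hr.ne'

theorem EuclideanSpace.apply_eq_sum_single {n : ℕ} (L : Euc n →L[ℝ] ℝ) (w : Euc n) :
    L w = ∑ i, L (EuclideanSpace.single i 1) * w i := by
  conv_lhs => rw [← (EuclideanSpace.basisFun (Fin n) ℝ).sum_repr w]
  simp [mul_comm]

theorem inner_gradient_gradient_eq_sum {n : ℕ} (u v : Euc n → ℝ) (x : Euc n) :
    ⟪gradient u x, gradient v x⟫ = ∑ i, fderiv ℝ u x (EuclideanSpace.single i 1) *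
      fderiv ℝ v x (EuclideanSpace.single i 1) := by
  have h : ∀ (f : Euc n → ℝ) i, gradient f x i = fderiv ℝ f x (EuclideanSpace.single i 1) := by
    intro f i
    rw [← inner_gradient_left, EuclideanSpace.inner_single_right]
    simp
  rw [inner_gradient_left, EuclideanSpace.apply_eq_sum_single]
  simp [h]

section
variable {E : Type*} [NormedAddCommGroup E] [NormedSpace ℝ E]

theorem ContDiffAt.fderiv_fderiv_apply_comm {f : E → ℝ} {x : E} (hf : ContDiffAt ℝ 2 f x)
    (a b : E) :
    fderiv ℝ (fun y => fderiv ℝ f y a) x b = fderiv ℝ (fun y => fderiv ℝ f y b) x a := by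
  have hd : DifferentiableAt ℝ (fderiv ℝ f) x :=
    (hf.fderiv_right (m := 1) (by norm_num)).differentiableAt one_ne_zero
  have h : ∀ w, fderiv ℝ (fun y => fderiv ℝ f y w) x = (fderiv ℝ (fderiv ℝ f) x).flip w := by
    intro w
    rw [fderiv_clm_apply hd (differentiableAt_const w)]
    simp
  rw [h, h]
  exact (hf.isSymmSndFDerivAt (by simp)) b a

theorem ContDiffOn.fderiv_apply_const {f : E → ℝ} {U : Set E} (hU : IsOpen U)
    (hf : ContDiffOn ℝ 2 f U) (w : E) : ContDiffOn ℝ 1 (fun y => fderiv ℝ f y w) U :=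
  (hf.fderiv_of_isOpen hU (by norm_num)).clm_apply contDiffOn_const
end

section
variable {n : ℕ}

/-- The Pohozaev vector field of the pair `(u, v)` in the direction of the `j`-th axis. -/
def pohozaevField (p q : ℝ) (u v : Euc n → ℝ) (j i : Fin n) (x : Euc n) : ℝ :=
  -(fderiv ℝ u x (EuclideanSpace.single i 1) * fderiv ℝ v x (EuclideanSpace.single j 1) +
      fderiv ℝ v x (EuclideanSpace.single i 1) * fderiv ℝ u x (EuclideanSpace.single j 1)) +
    (if i = j then 1 else 0) *
      (∑ k, fderiv ℝ u x (EuclideanSpace.single k 1) * fderiv ℝ v x (EuclideanSpace.single k 1) -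
        1 / (p + 1) * v x ^ (p + 1) - 1 / (q + 1) * u x ^ (q + 1))

variable {Ω : Set (Euc n)} {p q : ℝ} {u v : Euc n → ℝ}

theorem contDiffOn_pohozaevField (hΩ : IsOpen Ω) (hu : ContDiffOn ℝ 2 u Ω)
    (hv : ContDiffOn ℝ 2 v Ω) (hupos : ∀ x ∈ Ω, 0 < u x) (hvpos : ∀ x ∈ Ω, 0 < v x)
    (j i : Fin n) : ContDiffOn ℝ 1 (pohozaevField p q u v j i) Ω := by
  have du := fun i => hu.fderiv_apply_const hΩ (EuclideanSpace.single i (1 : ℝ))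
  have dv := fun i => hv.fderiv_apply_const hΩ (EuclideanSpace.single i (1 : ℝ))
  have hup := (hu.of_le one_le_two).rpow_const_of_ne (p := q + 1) fun x hx => (hupos x hx).ne'
  have hvp := (hv.of_le one_le_two).rpow_const_of_ne (p := p + 1) fun x hx => (hvpos x hx).ne'
  exact (((du i).mul (dv j)).add ((dv i).mul (du j))).neg.add (contDiffOn_const.mul
    (((ContDiffOn.sum fun k _ => (du k).mul (dv k)).sub (contDiffOn_const.mul hvp)).sub
      (contDiffOn_const.mul hup)))

theorem sum_fderiv_pohozaevField (hΩ : IsOpen Ω) (hp : 0 < p) (hq : 0 < q)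
    (hu : ContDiffOn ℝ 2 u Ω) (hv : ContDiffOn ℝ 2 v Ω)
    (hupos : ∀ x ∈ Ω, 0 < u x) (hvpos : ∀ x ∈ Ω, 0 < v x)
    (hequ : ∀ x ∈ Ω, -lap n u x = (v x) ^ p) (heqv : ∀ x ∈ Ω, -lap n v x = (u x) ^ q)
    (j : Fin n) {x : Euc n} (hx : x ∈ Ω) :
    ∑ i, fderiv ℝ (pohozaevField p q u v j i) x (EuclideanSpace.single i 1) = 0 := by
  have hux := hu.contDiffAt (hΩ.mem_nhds hx)
  have hvx := hv.contDiffAt (hΩ.mem_nhds hx)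
  have du := fun i => (((hu.fderiv_apply_const hΩ (EuclideanSpace.single i (1 : ℝ))).contDiffAt
    (hΩ.mem_nhds hx)).differentiableAt one_ne_zero).hasFDerivAt
  have dv := fun i => (((hv.fderiv_apply_const hΩ (EuclideanSpace.single i (1 : ℝ))).contDiffAt
    (hΩ.mem_nhds hx)).differentiableAt one_ne_zero).hasFDerivAt
  have hup := (hux.differentiableAt two_ne_zero).hasFDerivAt.rpow_const (p := q + 1)
    (Or.inl (hupos x hx).ne')
  have hvp := (hvx.differentiableAt two_ne_zero).hasFDerivAt.rpow_const (p := p + 1)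
    (Or.inl (hvpos x hx).ne')
  have hW := ((HasFDerivAt.fun_sum fun k (_ : k ∈ Finset.univ) => (du k).mul (dv k)).sub
    (hvp.const_mul (1 / (p + 1)))).sub (hup.const_mul (1 / (q + 1)))
  have hG := fun i => ((((du i).mul (dv j)).add ((dv i).mul (du j))).neg.add
    (hW.const_mul (if i = j then (1 : ℝ) else 0)))
  have hGe : ∀ i, fderiv ℝ (pohozaevField p q u v j i) x = _ := fun i => (hG i).fderiv
  simp only [hGe]
  have e1 := hequ x hx
  have e2 := heqv x hx
  have hp1 : p + 1 ≠ 0 := by positivity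
  have hq1 : q + 1 ≠ 0 := by positivity
  simp only [lap] at e1 e2
  have su := fun i => hux.fderiv_fderiv_apply_comm (EuclideanSpace.single i (1 : ℝ))
    (EuclideanSpace.single j 1)
  have sv := fun i => hvx.fderiv_fderiv_apply_comm (EuclideanSpace.single i (1 : ℝ))
    (EuclideanSpace.single j 1)
  simp only [add_apply, smul_apply,
    neg_apply, sub_apply, sum_apply,
    smul_eq_mul, ite_mul, one_mul, zero_mul, neg_add, Finset.sum_add_distrib,
    Finset.sum_neg_distrib, Finset.sum_ite_eq', Finset.mem_univ, if_true, ← Finset.mul_sum, su, sv,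
    add_sub_cancel_right]
  set A := v x ^ p
  set B := u x ^ q
  field_simp
  linear_combination e1 * fderiv ℝ v x (EuclideanSpace.single j 1) +
    e2 * fderiv ℝ u x (EuclideanSpace.single j 1)
end

theorem integral_neg_add_sub_sub {α : Type*} [MeasurableSpace α] {μ : Measure α}
    {f₁ f₂ f₃ f₄ : α → ℝ} (h₁ : Integrable f₁ μ) (h₂ : Integrable f₂ μ) (h₃ : Integrable f₃ μ)
    (h₄ : Integrable f₄ μ) (a b : ℝ) :
    ∫ x, (-f₁ x + f₂ x - a * f₃ x - b * f₄ x) ∂μ =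
      -(∫ x, f₁ x ∂μ) + (∫ x, f₂ x ∂μ) - a * (∫ x, f₃ x ∂μ) - b * (∫ x, f₄ x ∂μ) := by
  have h₁₂ : Integrable (fun x => -f₁ x + f₂ x) μ := h₁.neg.add h₂
  have h₁₂₃ : Integrable (fun x => -f₁ x + f₂ x - a * f₃ x) μ := h₁₂.sub (h₃.const_mul a)
  rw [integral_sub h₁₂₃ (h₄.const_mul b), integral_sub h₁₂ (h₃.const_mul a),
    integral_add h₁.fun_neg h₂, integral_neg, integral_const_mul, integral_const_mul]

/-- Pohozaev-type identity on spheres for solutions of the Lane–Emden system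
`-Δu = v^p`, `-Δv = u^q` on an open set `Ω ⊆ ℝⁿ`. -/
theorem pohozaev_identity_on_spheres
    (n : ℕ) (hn : 2 ≤ n)
    (Ω : Set (Euc n)) (hΩ : IsOpen Ω)
    (p q : ℝ) (hp : 0 < p) (hq : 0 < q)
    (u v : Euc n → ℝ)
    (hu : ContDiffOn ℝ 2 u Ω) (hv : ContDiffOn ℝ 2 v Ω)
    (hupos : ∀ x ∈ Ω, 0 < u x) (hvpos : ∀ x ∈ Ω, 0 < v x)
    (hequ : ∀ x ∈ Ω, -lap n u x = (v x) ^ p)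
    (heqv : ∀ x ∈ Ω, -lap n v x = (u x) ^ q)
    (x₀ : Euc n) (r : ℝ) (hr : 0 < r)
    (hball : closedBall x₀ r ⊆ Ω) (j : Fin n) :
    -(∫ x in sphere x₀ r,
        (fderiv ℝ u x (r⁻¹ • (x - x₀)) * fderiv ℝ v x (EuclideanSpace.single j 1)
          + fderiv ℝ v x (r⁻¹ • (x - x₀)) * fderiv ℝ u x (EuclideanSpace.single j 1))
        ∂(surf n))
      + ∫ x in sphere x₀ r, ⟪gradient u x, gradient v x⟫ * ((x j - x₀ j) / r) ∂(surf n)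
    = (1 / (p + 1)) * ∫ x in sphere x₀ r, (v x) ^ (p + 1) * ((x j - x₀ j) / r) ∂(surf n)
      + (1 / (q + 1)) * ∫ x in sphere x₀ r, (u x) ^ (q + 1) * ((x j - x₀ j) / r) ∂(surf n) := by
  have : NeZero n := ⟨by omega⟩
  have hG := contDiffOn_pohozaevField (p := p) (q := q) hΩ hu hv hupos hvpos j
  have hflux := integral_sphere_inner_normal_eq_zero hΩ hG
    (fun x hx => sum_fderiv_pohozaevField hΩ hp hq hu hv hupos hvpos hequ heqv j hx) hr hball
  have hsph : sphere x₀ r ⊆ Ω := sphere_subset_closedBall.trans hball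
  have du : ContinuousOn (fderiv ℝ u) Ω := hu.continuousOn_fderiv_of_isOpen hΩ one_le_two
  have dv : ContinuousOn (fderiv ℝ v) Ω := hv.continuousOn_fderiv_of_isOpen hΩ one_le_two
  have hup : ContinuousOn (fun x => u x ^ (q + 1)) Ω :=
    hu.continuousOn.rpow_const fun x hx => Or.inl (hupos x hx).ne'
  have hvp : ContinuousOn (fun x => v x ^ (p + 1)) Ω :=
    hv.continuousOn.rpow_const fun x hx => Or.inl (hvpos x hx).ne'
  have c1 : ContinuousOn (fun x =>
      fderiv ℝ u x (r⁻¹ • (x - x₀)) * fderiv ℝ v x (EuclideanSpace.single j 1)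
        + fderiv ℝ v x (r⁻¹ • (x - x₀)) * fderiv ℝ u x (EuclideanSpace.single j 1))
      (sphere x₀ r) := ContinuousOn.mono (by fun_prop) hsph
  have c2 : ContinuousOn (fun x => ⟪gradient u x, gradient v x⟫ * ((x j - x₀ j) / r))
      (sphere x₀ r) := by
    simp only [inner_gradient_gradient_eq_sum]
    exact ContinuousOn.mono (by fun_prop) hsph
  have c3 : ContinuousOn (fun x => v x ^ (p + 1) * ((x j - x₀ j) / r)) (sphere x₀ r) :=
    ContinuousOn.mono (by fun_prop) hsph
  have c4 : ContinuousOn (fun x => u x ^ (q + 1) * ((x j - x₀ j) / r)) (sphere x₀ r) :=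
    ContinuousOn.mono (by fun_prop) hsph
  obtain ⟨c, hc⟩ := exists_setIntegral_sphere_hausdorffMeasure_eq ((n : ℝ) - 1) x₀ hr
  have hint : ∀ f : Euc n → ℝ, ContinuousOn f (sphere x₀ r) →
      Integrable (fun θ : sphere (0 : Euc n) 1 => f (x₀ + r • (θ : Euc n)))
        (volume : Measure (Euc n)).toSphere := by
    intro f hf
    have : CompactSpace (sphere (0 : Euc n) 1) :=
      isCompact_iff_compactSpace.1 (isCompact_sphere 0 1)
    refine Continuous.integrable_of_hasCompactSupport (hf.comp_continuous (by fun_prop) fun θ => ?_)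
      (HasCompactSupport.of_compactSpace _)
    rw [← range_add_smul_sphere x₀ hr]
    exact ⟨θ, rfl⟩
  rw [surf, hc _ c1, hc _ c2, hc _ c3, hc _ c4]
  have i1 := hint _ c1
  have i2 := hint _ c2
  have i3 := hint _ c3
  have i4 := hint _ c4
  have hnormal : ∀ θ : sphere (0 : Euc n) 1, r⁻¹ • (x₀ + r • (θ : Euc n) - x₀) = θ := fun θ => by
    rw [add_sub_cancel_left, inv_smul_smul₀ hr.ne']
  have hcoord : ∀ θ : sphere (0 : Euc n) 1,
      ((x₀ + r • (θ : Euc n)) j - x₀ j) / r = (θ : Euc n) j := fun θ => by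
    simp [hr.ne']
  simp only [hnormal, hcoord] at i1 i2 i3 i4 ⊢
  have hpt : ∀ θ : sphere (0 : Euc n) 1,
      ∑ i, pohozaevField p q u v j i (x₀ + r • (θ : Euc n)) * (θ : Euc n) i =
        -(fderiv ℝ u (x₀ + r • (θ : Euc n)) θ *
            fderiv ℝ v (x₀ + r • (θ : Euc n)) (EuclideanSpace.single j 1) +
          fderiv ℝ v (x₀ + r • (θ : Euc n)) θ *
            fderiv ℝ u (x₀ + r • (θ : Euc n)) (EuclideanSpace.single j 1)) +
        ⟪gradient u (x₀ + r • (θ : Euc n)), gradient v (x₀ + r • (θ : Euc n))⟫ * (θ : Euc n) j -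
        1 / (p + 1) * (v (x₀ + r • (θ : Euc n)) ^ (p + 1) * (θ : Euc n) j) -
        1 / (q + 1) * (u (x₀ + r • (θ : Euc n)) ^ (q + 1) * (θ : Euc n) j) := fun θ => by
    rw [inner_gradient_gradient_eq_sum,
      EuclideanSpace.apply_eq_sum_single (fderiv ℝ u _) θ,
      EuclideanSpace.apply_eq_sum_single (fderiv ℝ v _) θ]
    simp only [pohozaevField, add_mul, neg_mul, ite_mul, one_mul, zero_mul,
      Finset.sum_add_distrib, Finset.sum_neg_distrib, Finset.sum_ite_eq',
      Finset.mem_univ, if_true]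
    have h : ∀ f g : Fin n → ℝ, ∀ a : ℝ, ∑ i, f i * a * g i = (∑ i, f i * g i) * a := by
      intro f g a
      rw [Finset.sum_mul]
      exact Finset.sum_congr rfl fun i _ => by ring
    rw [h, h]
    ring
  simp only [hpt] at hflux
  have hlin := (integral_neg_add_sub_sub i1 i2 i3 i4 (1 / (p + 1)) (1 / (q + 1))).symm.trans hflux
  linear_combination c * hlin
end
end

section
/- Let n ≥ 3 and 1 ≤ p < n/(n−2). Let x₀ ∈ ℝⁿ, R > 0, let H ∈ C¹(B(x₀,R)), and set G(x) := c_n|x−x₀|^{2−n} − H(x) for x ∈ B(x₀,R)∖{x₀}; assume G > 0 on B(x₀,R)∖{x₀}. Then for every j ∈ {1,…,n}: lim_{r→0⁺} ∫_{∂B(x₀,r)} G(x)^{p+1} ν_j(x) dS(x) = 0. -/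
open MeasureTheory Metric Filter Topology RealInnerProductSpace

noncomputable section

noncomputable def omegaSph (n : ℕ) : ℝ := (surf n (sphere (0 : Euc n) 1)).toReal

/-- `c_n = 1/((n-2) ω_{n-1})`. -/
noncomputable def cGreen (n : ℕ) : ℝ := 1 / (((n : ℝ) - 2) * omegaSph n)

/-- A set integral whose integrand is nearly odd under a measure-preserving symmetry is small. -/
theorem norm_setIntegral_le_of_norm_add_comp_le {α : Type*} [MeasurableSpace α] {μ : Measure α}
    {σ : α → α} (hσ : MeasurePreserving σ μ μ) (hσe : MeasurableEmbedding σ) {s : Set α}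
    (hs : σ ⁻¹' s = s) (hμs : μ s < ⊤) {f : α → ℝ} {C : ℝ} (hC : 0 ≤ C)
    (h : ∀ x ∈ s, ‖f x + f (σ x)‖ ≤ C) :
    ‖∫ x in s, f x ∂μ‖ ≤ C * μ.real s := by
  by_cases hf : IntegrableOn f s μ
  · have hfσ : IntegrableOn (fun x => f (σ x)) s μ := by
      have := (hσ.integrableOn_comp_preimage hσe (f := f) (s := s)).2 hf
      rwa [hs] at this
    have heq : ∫ x in s, f (σ x) ∂μ = ∫ x in s, f x ∂μ := by
      have := hσ.setIntegral_preimage_emb hσe f s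
      rwa [hs] at this
    have hadd : ∫ x in s, (f x + f (σ x)) ∂μ = 2 * ∫ x in s, f x ∂μ := by
      rw [integral_add hf hfσ, heq, two_mul]
    have hle := norm_setIntegral_le_of_norm_le_const hμs h
    rw [hadd, norm_mul, Real.norm_two] at hle
    linarith [norm_nonneg (∫ x in s, f x ∂μ)]
  · rw [integral_undef hf, norm_zero]
    positivity

/-- On `[0, M]` the function `x ↦ x ^ q`, `q ≥ 1`, is Lipschitz with constant `q * M ^ (q - 1)`. -/
theorem abs_rpow_sub_rpow_le {q M a b : ℝ} (hq : 1 ≤ q) (ha : a ∈ Set.Icc 0 M)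
    (hb : b ∈ Set.Icc 0 M) : |a ^ q - b ^ q| ≤ q * M ^ (q - 1) * |a - b| := by
  have := (convex_Icc (0 : ℝ) M).norm_image_sub_le_of_norm_hasDerivWithin_le
    (f := fun x => x ^ q) (f' := fun x => q * x ^ (q - 1)) (C := q * M ^ (q - 1))
    (fun x _ => (Real.hasDerivAt_rpow_const (Or.inr hq)).hasDerivWithinAt)
    (fun x hx => by
      have := Real.rpow_nonneg hx.1 (q - 1)
      rw [Real.norm_of_nonneg (by positivity)]
      exact mul_le_mul_of_nonneg_left
        (Real.rpow_le_rpow hx.1 hx.2 (by linarith)) (by linarith)) hb ha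
  simpa [Real.norm_eq_abs] using this

section UnitSphere

variable {E : Type*} [NormedAddCommGroup E] [InnerProductSpace ℝ E] [FiniteDimensional ℝ E]
  [MeasurableSpace E] [BorelSpace E]

theorem hausdorffMeasure_hemisphere_lt_top {m : ℕ} [Fact (Module.finrank ℝ E = m + 1)]
    {v : E} (hv : ‖v‖ = 1) :
    μH[m] (sphere (0 : E) 1 ∩ {x | ⟪v, x⟫ ≤ 0}) < ⊤ := by
  have hcpt : IsCompact (sphere (0 : E) 1 ∩ {x | ⟪v, x⟫ ≤ 0}) :=
    (isCompact_sphere _ _).inter_right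
      (isClosed_le (continuous_const.inner continuous_id) continuous_const)
  have hne : ∀ x ∈ sphere (0 : E) 1 ∩ {x | ⟪v, x⟫ ≤ 0}, ⟪v, x⟫ ≠ 1 := fun x hx h => by
    have : ⟪v, x⟫ ≤ 0 := hx.2
    linarith
  obtain ⟨B, hB⟩ := (hcpt.image_of_continuousOn
    ((continuousOn_stereoToFun (v := v)).mono hne)).isBounded.subset_closedBall 0
  obtain ⟨K, hK⟩ := (contDiff_stereoInvFunAux (v := v) (m := 1)).contDiffOn.exists_lipschitzOnWith
    one_ne_zero (convex_closedBall (0 : E) B) (isCompact_closedBall _ _)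
  have hfin : Module.finrank ℝ (ℝ ∙ v)ᗮ = m :=
    Submodule.finrank_orthogonal_span_singleton (by rintro rfl; simp at hv)
  set c : (ℝ ∙ v)ᗮ → E := fun w => w
  have hLip : LipschitzOnWith K (stereoInvFunAux v) (c '' closedBall 0 B) :=
    hK.mono (by rintro _ ⟨w, hw, rfl⟩; simpa [c] using hw)
  have hsub : sphere (0 : E) 1 ∩ {x | ⟪v, x⟫ ≤ 0} ⊆
      stereoInvFunAux v '' (c '' closedBall 0 B) := by
    intro x hx
    refine ⟨_, ⟨stereoToFun v x, hB ⟨x, hx, rfl⟩, rfl⟩, ?_⟩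
    have hxv : x ≠ v := by
      rintro rfl
      exact hne x hx (by simp [hv])
    exact congrArg Subtype.val (stereo_left_inv hv (x := ⟨x, hx.1⟩) hxv)
  have hball : μH[m] (closedBall (0 : (ℝ ∙ v)ᗮ) B) < ⊤ := by
    have := (isCompact_closedBall (0 : (ℝ ∙ v)ᗮ) B).measure_lt_top
      (μ := μH[Module.finrank ℝ (ℝ ∙ v)ᗮ])
    rwa [hfin] at this
  calc μH[m] (sphere (0 : E) 1 ∩ {x | ⟪v, x⟫ ≤ 0})
      ≤ μH[m] (stereoInvFunAux v '' (c '' closedBall 0 B)) := measure_mono hsub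
    _ ≤ (K : ENNReal) ^ (m : ℝ) * μH[m] (c '' closedBall 0 B) :=
      hLip.hausdorffMeasure_image_le m.cast_nonneg
    _ = (K : ENNReal) ^ (m : ℝ) * μH[m] (closedBall (0 : (ℝ ∙ v)ᗮ) B) := by
      rw [Isometry.hausdorffMeasure_image isometry_subtype_coe (Or.inl m.cast_nonneg)]
    _ < ⊤ := ENNReal.mul_lt_top
      (ENNReal.rpow_lt_top_of_nonneg m.cast_nonneg ENNReal.coe_ne_top) hball

theorem hausdorffMeasure_unit_sphere_lt_top {m : ℕ} [Fact (Module.finrank ℝ E = m + 1)] :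
    μH[m] (sphere (0 : E) 1) < ⊤ := by
  rcases (sphere (0 : E) 1).eq_empty_or_nonempty with h | ⟨v, hv⟩
  · simp [h]
  have hv : ‖v‖ = 1 := by simpa using hv
  refine (measure_mono fun x hx => ?_).trans_lt <| measure_union_lt_top
    (hausdorffMeasure_hemisphere_lt_top (m := m) hv)
    (hausdorffMeasure_hemisphere_lt_top (m := m) (v := -v) (by simpa using hv))
  rcases le_total ⟪v, x⟫ 0 with h | h
  · exact Or.inl ⟨hx, h⟩
  · exact Or.inr ⟨hx, by simpa [inner_neg_left] using h⟩

end UnitSphere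

theorem surf_unit_sphere_lt_top {n : ℕ} (hn : 1 ≤ n) : surf n (sphere (0 : Euc n) 1) < ⊤ := by
  obtain ⟨m, rfl⟩ := Nat.exists_eq_add_of_le' hn
  have : Fact (Module.finrank ℝ (Euc (m + 1)) = m + 1) := ⟨by simp⟩
  simpa [surf] using hausdorffMeasure_unit_sphere_lt_top (E := Euc (m + 1)) (m := m)

theorem surf_sphere_le {n : ℕ} (hn : 1 ≤ n) (x₀ : Euc n) {r : ℝ} (hr : 0 < r) :
    surf n (sphere x₀ r) ≤
      ENNReal.ofReal (r ^ ((n : ℝ) - 1)) * surf n (sphere (0 : Euc n) 1) := by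
  have hd : (0 : ℝ) ≤ (n : ℝ) - 1 := by
    have : (1 : ℝ) ≤ n := by exact_mod_cast hn
    linarith
  have hLip : LipschitzWith r.toNNReal (fun y : Euc n => x₀ + r • y) :=
    LipschitzWith.of_dist_le_mul fun y z => by
      simp [dist_smul₀, abs_of_pos hr, hr.le]
  have hsub : sphere x₀ r ⊆ (fun y : Euc n => x₀ + r • y) '' sphere 0 1 := fun x hx => by
    have hx : ‖x - x₀‖ = r := by simpa [dist_eq_norm] using hx
    refine ⟨r⁻¹ • (x - x₀), ?_, ?_⟩
    · simp [norm_smul, hx, abs_of_pos hr, hr.ne']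
    · simp [smul_smul, hr.ne']
  refine (measure_mono hsub).trans ((hLip.hausdorffMeasure_image_le hd _).trans_eq ?_)
  rw [← ENNReal.ofReal_rpow_of_pos hr]
  rfl

theorem surf_real_sphere_le {n : ℕ} (hn : 1 ≤ n) (x₀ : Euc n) {r : ℝ} (hr : 0 < r) :
    (surf n).real (sphere x₀ r) ≤ r ^ ((n : ℝ) - 1) * omegaSph n := by
  have := ENNReal.toReal_mono
    (ENNReal.mul_lt_top ENNReal.ofReal_lt_top (surf_unit_sphere_lt_top hn)).ne
    (surf_sphere_le hn x₀ hr)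
  rwa [ENNReal.toReal_mul, ENNReal.toReal_ofReal (by positivity)] at this

theorem surf_sphere_lt_top {n : ℕ} (hn : 1 ≤ n) (x₀ : Euc n) {r : ℝ} (hr : 0 < r) :
    surf n (sphere x₀ r) < ⊤ :=
  (surf_sphere_le hn x₀ hr).trans_lt
    (ENNReal.mul_lt_top ENNReal.ofReal_lt_top (surf_unit_sphere_lt_top hn))

/-- The flux integrals of `G^{p+1}` over small spheres around the singularity vanish
in the limit when `p < n/(n-2)`. -/
theorem sphere_integral_G_pow_tendsto_zero
    (n : ℕ) (hn : 3 ≤ n)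
    (p : ℝ) (hp1 : 1 ≤ p) (hp2 : p < (n : ℝ) / ((n : ℝ) - 2))
    (x₀ : Euc n) (R : ℝ) (hR : 0 < R)
    (H : Euc n → ℝ) (hH : ContDiffOn ℝ 1 H (ball x₀ R))
    (G : Euc n → ℝ)
    (hG : ∀ x, x ≠ x₀ → G x = cGreen n * ‖x - x₀‖ ^ ((2 : ℝ) - n) - H x)
    (hGpos : ∀ x ∈ ball x₀ R, x ≠ x₀ → 0 < G x)
    (j : Fin n) :
    Filter.Tendsto
      (fun r : ℝ => ∫ x in sphere x₀ r, (G x) ^ (p + 1) * ((x j - x₀ j) / r) ∂(surf n))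
      (nhdsWithin 0 (Set.Ioi 0)) (nhds 0) := by
  have hn1 : 1 ≤ n := by omega
  have hn3 : (3 : ℝ) ≤ n := by exact_mod_cast hn
  have hω : 0 ≤ omegaSph n := ENNReal.toReal_nonneg
  have hc : 0 ≤ cGreen n := by
    have : (0 : ℝ) ≤ (n : ℝ) - 2 := by linarith
    rw [cGreen]
    positivity
  have he : 0 < n + (2 - (n : ℝ)) * p := by
    rw [lt_div_iff₀ (by linarith)] at hp2
    linarith
  obtain ⟨K, t, ht, hK⟩ :=
    (hH.contDiffAt (isOpen_ball.mem_nhds (mem_ball_self hR))).exists_lipschitzOnWith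
  obtain ⟨δ, hδ, hδt⟩ := Metric.mem_nhds_iff.1 ht
  set M : ℝ := cGreen n + (|H x₀| + K) with hM
  have hM0 : 0 ≤ M := by positivity
  set C : ℝ := (p + 1) * M ^ p * (K * 2) * omegaSph n with hCdef
  have hlim : Tendsto (fun r : ℝ => C * r ^ (n + (2 - (n : ℝ)) * p)) (𝓝[>] 0) (𝓝 0) := by
    have h := ((Real.continuousAt_rpow_const 0 _ (Or.inr he.le)).tendsto.const_mul C).mono_left
      (nhdsWithin_le_nhds (s := Set.Ioi (0 : ℝ)))
    rwa [Real.zero_rpow he.ne', mul_zero] at h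
  refine squeeze_zero_norm' ?_ hlim
  have hρ : 0 < min (min R δ) 1 := by positivity
  filter_upwards [Ioo_mem_nhdsGT hρ] with r ⟨hr, hrρ⟩
  have hrR : r < R := hrρ.trans_le ((min_le_left _ _).trans (min_le_left _ _))
  have hrδ : r < δ := hrρ.trans_le ((min_le_left _ _).trans (min_le_right _ _))
  have hr1 : r < 1 := hrρ.trans_le (min_le_right _ _)
  set P : ℝ := r ^ ((2 : ℝ) - n) with hP
  have hP1 : 1 ≤ P := Real.one_le_rpow_of_pos_of_le_one_of_nonpos hr hr1.le (by linarith)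
  have hne : ∀ x ∈ sphere x₀ r, x ≠ x₀ := fun x hx => ne_of_mem_sphere hx hr.ne'
  have hmem : ∀ x ∈ sphere x₀ r, x ∈ t := fun x hx =>
    hδt (sphere_subset_closedBall.trans (closedBall_subset_ball hrδ) hx)
  have hGeq : ∀ x ∈ sphere x₀ r, G x = cGreen n * P - H x := fun x hx => by
    rw [hG x (hne x hx), mem_sphere_iff_norm.1 hx]
  have hGmem : ∀ x ∈ sphere x₀ r, G x ∈ Set.Icc 0 (M * P) := fun x hx => by
    refine ⟨(hGpos x (sphere_subset_ball hrR hx) (hne x hx)).le, ?_⟩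
    have hHd := hK.dist_le_mul x (hmem x hx) x₀ (mem_of_mem_nhds ht)
    rw [mem_sphere.1 hx, Real.dist_eq] at hHd
    have hKr : (K : ℝ) * r ≤ K := mul_le_of_le_one_right K.2 hr1.le
    have hH' : -H x ≤ |H x₀| + K := by
      linarith [neg_abs_le (H x - H x₀), neg_abs_le (H x₀)]
    have := le_mul_of_one_le_right (show 0 ≤ |H x₀| + (K : ℝ) by positivity) hP1
    rw [hGeq x hx, hM, add_mul]
    linarith
  set σ : Euc n ≃ᵢ Euc n := IsometryEquiv.subLeft (x₀ + x₀) with hσdef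
  have hσ : ∀ x, σ x = x₀ + x₀ - x := fun x => rfl
  have hσd : ∀ x, dist (σ x) x₀ = dist x x₀ := fun x => by
    rw [hσ, dist_eq_norm, dist_eq_norm, ← norm_neg (x - x₀)]
    congr 1
    abel
  have hσs : ∀ x, σ x ∈ sphere x₀ r ↔ x ∈ sphere x₀ r := fun x => by
    rw [mem_sphere, mem_sphere, hσd]
  have hbound : ∀ x ∈ sphere x₀ r,
      ‖(G x) ^ (p + 1) * ((x j - x₀ j) / r) + (G (σ x)) ^ (p + 1) * ((σ x j - x₀ j) / r)‖ ≤
        (p + 1) * (M * P) ^ p * (K * (2 * r)) := fun x hx => by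
    have hσx := (hσs x).2 hx
    have hodd : σ x j - x₀ j = -(x j - x₀ j) := by
      rw [hσ]
      simp only [PiLp.sub_apply, PiLp.add_apply]
      ring
    have hν : |(x j - x₀ j) / r| ≤ 1 := by
      rw [abs_div, abs_of_pos hr, div_le_one hr, ← mem_sphere_iff_norm.1 hx]
      exact PiLp.norm_apply_le (x - x₀) j
    have hGd : |G x - G (σ x)| ≤ K * (2 * r) := by
      have hHd := hK.dist_le_mul (σ x) (hmem _ hσx) x (hmem x hx)
      rw [Real.dist_eq] at hHd
      have htri : dist (σ x) x ≤ 2 * r := by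
        have := dist_triangle_right (σ x) x x₀
        rw [hσd, mem_sphere.1 hx] at this
        linarith
      rw [hGeq x hx, hGeq _ hσx, sub_sub_sub_cancel_left]
      exact hHd.trans (mul_le_mul_of_nonneg_left htri K.2)
    have hpow := abs_rpow_sub_rpow_le (q := p + 1) (by linarith) (hGmem x hx) (hGmem _ hσx)
    rw [add_sub_cancel_right] at hpow
    rw [hodd, neg_div, mul_neg, ← sub_eq_add_neg, ← sub_mul, norm_mul, Real.norm_eq_abs,
      Real.norm_eq_abs]
    refine (mul_le_of_le_one_right (abs_nonneg _) hν).trans (hpow.trans ?_)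
    exact mul_le_mul_of_nonneg_left hGd (by positivity)
  have hpre : σ ⁻¹' sphere x₀ r = sphere x₀ r := Set.ext hσs
  have hmp : MeasurePreserving σ (surf n) (surf n) := σ.measurePreserving_hausdorffMeasure _
  refine (norm_setIntegral_le_of_norm_add_comp_le hmp σ.toHomeomorph.measurableEmbedding hpre
    (surf_sphere_lt_top hn1 x₀ hr) (by positivity) hbound).trans ?_
  refine (mul_le_mul_of_nonneg_left (surf_real_sphere_le hn1 x₀ hr) (by positivity)).trans_eq ?_
  have hexp : r ^ (n + (2 - (n : ℝ)) * p) = P ^ p * r * r ^ ((n : ℝ) - 1) := by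
    rw [hP, ← Real.rpow_mul hr.le, ← Real.rpow_add_one hr.ne', ← Real.rpow_add hr]
    congr 1
    ring
  rw [hexp, hCdef, Real.mul_rpow hM0 (by positivity)]
  ring
end
end
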